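/- arXiv:1111.1163 — 2 statements merged into one kernel-verified Lean document; each statement's English description precedes it below -/
import Mathlib

section
/- Fix $L>0$ and $a$ with $a^2<L^2$, let $\Delta:(0,\infty)\to\mathbb{R}$ be differentiable, let $\Delta_\theta(\theta) = 1-\frac{a^2}{L^2}\cos^2\theta$, and let $\rho>0$ satisfy $\Delta(\rho)>0$ and $\Delta'(\rho)\neq 0$. Let $A$ be differentiable at $\rho$ with $A(\rho)>0$ and $\frac{A'(\rho)}{A(\rho)} = \frac{2}{\Delta'(\rho)}\Big(1+\frac{a^2}{L^2}\Big)$. Define $r(\rho,\theta) = \sqrt{\Delta(\rho)}\,\sqrt{\Delta_\theta(\theta)}\,\sin\theta$ and $w(\rho,\theta) = \frac{A(\rho)\cos\theta}{\sqrt{1-\frac{a^2}{L^2}\cos 2\theta}}$. Then for every $\theta\in(0,\pi)$ the orthogonality relation $\Delta(\rho)\,\partial_\rho r\,\partial_\rho w + \Delta_\theta(\theta)\,\partial_\theta r\,\partial_\theta w = 0$ holds. -/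
open Real

/-- The polar derivative of `√(1 - k cos² θ) sin θ`. -/
theorem hasDerivAt_sqrt_one_sub_mul_cos_sq_mul_sin {k θ : ℝ} (h : 0 < 1 - k * cos θ ^ 2) :
    HasDerivAt (fun t => √(1 - k * cos t ^ 2) * sin t)
      (cos θ * (1 - k * cos (2 * θ)) / √(1 - k * cos θ ^ 2)) θ := by
  have hs : √(1 - k * cos θ ^ 2) ≠ 0 := (Real.sqrt_pos.2 h).ne'
  have hsq : √(1 - k * cos θ ^ 2) ^ 2 = 1 - k * cos θ ^ 2 := Real.sq_sqrt h.le
  have hd := (((((hasDerivAt_cos θ).pow 2).const_mul k).const_sub 1).sqrt h.ne').mul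
    (hasDerivAt_sin θ)
  refine hd.congr_deriv ?_
  simp only [Pi.pow_apply]
  rw [cos_two_mul]
  field_simp
  rw [hsq]
  linear_combination 2 * k * cos θ * sin_sq_add_cos_sq θ

/-- The polar derivative of `cos θ / √(1 - k cos 2θ)`. -/
theorem hasDerivAt_cos_div_sqrt_one_sub_mul_cos_two_mul {k θ : ℝ}
    (h : 0 < 1 - k * cos (2 * θ)) :
    HasDerivAt (fun t => cos t / √(1 - k * cos (2 * t)))
      (-(sin θ * (1 + k)) / √(1 - k * cos (2 * θ)) ^ 3) θ := by
  have hs : √(1 - k * cos (2 * θ)) ≠ 0 := (Real.sqrt_pos.2 h).ne'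
  have hsq : √(1 - k * cos (2 * θ)) ^ 2 = 1 - k * cos (2 * θ) := Real.sq_sqrt h.le
  have hd := (hasDerivAt_cos θ).div
    ((((((hasDerivAt_id θ).const_mul 2).cos).const_mul k).const_sub 1).sqrt h.ne') hs
  refine hd.congr_deriv ?_
  simp only [id]
  field_simp
  rw [hsq, sin_two_mul, cos_two_mul]
  ring

theorem kerr_newman_ads4_canonical_orthogonality
    (L a : ℝ) (hL : 0 < L) (ha : a^2 < L^2)
    (Δ : ℝ → ℝ) (hΔdiff : DifferentiableOn ℝ Δ (Set.Ioi (0:ℝ)))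
    (Δθ : ℝ → ℝ) (hΔθ : ∀ θ : ℝ, Δθ θ = 1 - a^2/L^2 * (Real.cos θ)^2)
    (ρ : ℝ) (hρ : 0 < ρ) (hΔpos : 0 < Δ ρ) (hΔ' : deriv Δ ρ ≠ 0)
    (A : ℝ → ℝ) (hA : DifferentiableAt ℝ A ρ) (hApos : 0 < A ρ)
    (hAeq : deriv A ρ / A ρ = 2 / deriv Δ ρ * (1 + a^2/L^2))
    (r w : ℝ → ℝ → ℝ)
    (hr : ∀ x θ : ℝ, r x θ = Real.sqrt (Δ x) * Real.sqrt (Δθ θ) * Real.sin θ)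
    (hw : ∀ x θ : ℝ, w x θ =
      A x * Real.cos θ / Real.sqrt (1 - a^2/L^2 * Real.cos (2*θ))) :
    ∀ θ ∈ Set.Ioo (0:ℝ) π,
      Δ ρ * deriv (fun x => r x θ) ρ * deriv (fun x => w x θ) ρ
        + Δθ θ * deriv (fun t => r ρ t) θ * deriv (fun t => w ρ t) θ = 0 := by
  intro θ _
  have hL2 : 0 < L ^ 2 := by positivity
  have hk0 : 0 ≤ a ^ 2 / L ^ 2 := by positivity
  have hk1 : a ^ 2 / L ^ 2 < 1 := (div_lt_one hL2).2 ha
  obtain rfl : Δθ = fun θ => 1 - a ^ 2 / L ^ 2 * cos θ ^ 2 := funext hΔθ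
  obtain rfl : r = fun x θ => √(Δ x) * √(1 - a ^ 2 / L ^ 2 * cos θ ^ 2) * sin θ :=
    funext₂ hr
  obtain rfl : w = fun x θ => A x * cos θ / √(1 - a ^ 2 / L ^ 2 * cos (2 * θ)) :=
    funext₂ hw
  clear hr hw hΔθ
  generalize a ^ 2 / L ^ 2 = k at *
  have hE : 0 < 1 - k * cos θ ^ 2 := by nlinarith [cos_sq_le_one θ]
  have hD : 0 < 1 - k * cos (2 * θ) := by nlinarith [cos_le_one (2 * θ)]
  have hΔ := (hΔdiff.differentiableAt (Ioi_mem_nhds hρ)).hasDerivAt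
  have hrρ := (((hΔ.sqrt hΔpos.ne').mul_const √(1 - k * cos θ ^ 2)).mul_const (sin θ)).deriv
  have hwρ := ((hA.hasDerivAt.mul_const (cos θ)).div_const √(1 - k * cos (2 * θ))).deriv
  have hrθ := ((hasDerivAt_sqrt_one_sub_mul_cos_sq_mul_sin hE).const_mul √(Δ ρ)).deriv
  have hwθ := ((hasDerivAt_cos_div_sqrt_one_sub_mul_cos_two_mul hD).const_mul (A ρ)).deriv
  simp only [← mul_assoc, ← mul_div_assoc] at hrθ hwθ
  have hA' : deriv A ρ * deriv Δ ρ = 2 * A ρ * (1 + k) := by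
    field_simp at hAeq
    linear_combination hAeq
  simp only [hrρ, hwρ, hrθ, hwθ]
  have hΔsq := Real.sq_sqrt hΔpos.le
  have hEsq := Real.sq_sqrt hE.le
  have hDsq := Real.sq_sqrt hD.le
  have hΔ0 := Real.sqrt_pos.2 hΔpos
  have hE0 := Real.sqrt_pos.2 hE
  have hD0 := Real.sqrt_pos.2 hD
  generalize √(Δ ρ) = d at *
  generalize √(1 - k * cos θ ^ 2) = e at *
  generalize √(1 - k * cos (2 * θ)) = f at *
  rw [← hΔsq, ← hEsq, ← hDsq]
  field_simp
  linear_combination d * e * sin θ * cos θ * hA'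
end

section
/- Let $\Xi_1,\Xi_2>0$ with $\epsilon := \Xi_1-\Xi_2 \neq 0$, and set $d = 2\sqrt{\epsilon^2+\Xi_1\Xi_2}$, $u(\theta) = 3\epsilon\cos 2\theta + \Xi_1+\Xi_2$, and $g(\theta) = \frac{4}{3\epsilon}\,\frac{u(\theta)-d}{u(\theta)+d}$. Then: (i) $u(\theta)+d>0$ for all $\theta\in[0,\pi/2]$, so $g$ is well defined; (ii) $g$ is strictly decreasing on $[0,\pi/2]$; (iii) $g'(0) = g'(\pi/2) = 0$. -/
open Real

lemma neg_lt_two_mul_sqrt {a b : ℝ} (ha : 0 < a) (hb : 0 < b) (hab : a ≠ b) :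
    -(4 * b - 2 * a) < 2 * √((a - b) ^ 2 + a * b) := by
  have h : a - 2 * b < √((a - b) ^ 2 + a * b) := by
    rcases lt_or_gt_of_ne hab with h | h
    · exact (show a - 2 * b < 0 by linarith).trans_le (sqrt_nonneg _)
    · apply lt_sqrt_of_sq_lt
      nlinarith [mul_pos hb (sub_pos.2 h)]
  linarith

theorem kerr_ads5_axial_function_monotone
    (Ξ1 Ξ2 : ℝ) (hΞ1 : 0 < Ξ1) (hΞ2 : 0 < Ξ2)
    (ε : ℝ) (hε : ε = Ξ1 - Ξ2) (hεne : ε ≠ 0)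
    (d : ℝ) (hd : d = 2 * Real.sqrt (ε^2 + Ξ1*Ξ2))
    (u : ℝ → ℝ) (hu : ∀ θ : ℝ, u θ = 3*ε*Real.cos (2*θ) + Ξ1 + Ξ2)
    (g : ℝ → ℝ) (hg : ∀ θ : ℝ, g θ = 4/(3*ε) * ((u θ - d)/(u θ + d))) :
    (∀ θ ∈ Set.Icc (0:ℝ) (π/2), 0 < u θ + d) ∧
    StrictAntiOn g (Set.Icc (0:ℝ) (π/2)) ∧
    deriv g 0 = 0 ∧ deriv g (π/2) = 0 := by
  have hne : Ξ1 ≠ Ξ2 := fun h => hεne (by rw [hε, h, sub_self])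
  have hdpos : 0 < d := by rw [hd]; positivity
  have h1 : 0 < 4 * Ξ2 - 2 * Ξ1 + d := by
    have := neg_lt_two_mul_sqrt hΞ1 hΞ2 hne
    rw [← hε, ← hd] at this
    linarith
  have h2 : 0 < 4 * Ξ1 - 2 * Ξ2 + d := by
    have := neg_lt_two_mul_sqrt hΞ2 hΞ1 hne.symm
    rw [show (Ξ2 - Ξ1) ^ 2 + Ξ2 * Ξ1 = ε ^ 2 + Ξ1 * Ξ2 by rw [hε]; ring, ← hd] at this
    linarith
  have hpos (θ : ℝ) : 0 < u θ + d := by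
    rw [hu, hε]
    have hl := neg_one_le_cos (2 * θ)
    have hr := cos_le_one (2 * θ)
    rcases le_total Ξ2 Ξ1 with h | h <;> nlinarith
  have hderiv (θ : ℝ) (hθ : sin (2 * θ) = 0) : deriv g θ = 0 := by
    have hu' : HasDerivAt u 0 θ := by
      have := ((((hasDerivAt_id θ).const_mul 2).cos.const_mul (3 * ε)).add_const Ξ1).add_const Ξ2
      rw [funext hu]
      simpa [hθ] using this
    have := ((hu'.sub_const d).div (hu'.add_const d) (hpos θ).ne').const_mul (4 / (3 * ε))
    rw [funext hg]
    simpa using this.deriv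
  refine ⟨fun θ _ => hpos θ, fun x hx y hy hxy => ?_, hderiv 0 (by simp),
    hderiv (π / 2) (by rw [mul_div_cancel₀ π two_ne_zero, sin_pi])⟩
  have hcos : cos (2 * y) < cos (2 * x) :=
    strictAntiOn_cos ⟨by linarith [hx.1], by linarith [hx.2]⟩
      ⟨by linarith [hy.1], by linarith [hy.2]⟩ (by linarith)
  have key : g x - g y = 8 * d * (cos (2 * x) - cos (2 * y)) / ((u x + d) * (u y + d)) := by
    have hx' := (hpos x).ne'
    have hy' := (hpos y).ne'
    rw [hg, hg]
    field_simp
    rw [hu, hu]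
    ring
  rw [← sub_pos, key]
  exact div_pos (mul_pos (by positivity) (sub_pos.2 hcos)) (mul_pos (hpos x) (hpos y))
end
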